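/- arXiv:1709.09856 — 4 statements merged into one kernel-verified Lean document; each statement's English description precedes it below -/
import Mathlib

section
/- Let n ≥ 2, b ∈ ℝⁿ, λ > 0. If p⋆ ∈ P^{n−1} minimizes h over P^{n−1}, then the vector u⋆ = Π_U(b − λ L p⋆) minimizes the function u ↦ λ‖Tu‖₁ + (1/2)‖u − b‖² over the set U. -/
open scoped RealInnerProductSpace

section NearestPoint

variable {E : Type*} [NormedAddCommGroup E] [InnerProductSpace ℝ E] {U : Set E} {proj : E → E}

lemma inner_sub_nearest_le_zero (hU : Convex ℝ U)
    (hproj : ∀ x, proj x ∈ U ∧ ∀ y ∈ U, ‖x - proj x‖ ≤ ‖x - y‖) (x : E) {y : E} (hy : y ∈ U) :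
    ⟪x - proj x, y - proj x⟫ ≤ 0 := by
  refine (norm_eq_iInf_iff_real_inner_le_zero hU (hproj x).1).1 ?_ y hy
  have : Nonempty U := ⟨⟨y, hy⟩⟩
  refine le_antisymm (le_ciInf fun w => (hproj x).2 w w.2) ?_
  exact ciInf_le (f := fun w : U => ‖x - w‖)
    ⟨0, by rintro _ ⟨w, rfl⟩; exact norm_nonneg _⟩ ⟨proj x, (hproj x).1⟩

lemma norm_nearest_sub_nearest_le (hU : Convex ℝ U)
    (hproj : ∀ x, proj x ∈ U ∧ ∀ y ∈ U, ‖x - proj x‖ ≤ ‖x - y‖) (x y : E) :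
    ‖proj x - proj y‖ ≤ ‖x - y‖ := by
  have h1 := inner_sub_nearest_le_zero hU hproj x (hproj y).1
  have h2 := inner_sub_nearest_le_zero hU hproj y (hproj x).1
  have h3 : ‖proj x - proj y‖ ^ 2 ≤ ⟪x - y, proj x - proj y⟫ := by
    rw [← real_inner_self_eq_norm_sq]
    simp only [inner_sub_left, inner_sub_right] at *
    linarith [real_inner_comm (proj x) (proj y)]
  have h4 := h3.trans (real_inner_le_norm _ _)
  by_contra! hlt
  nlinarith [norm_nonneg (x - y)]

/-- If `x ↦ ‖x‖² - dist(x, U)²` does not decrease from `x` in the direction `v`, then `v` has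
nonnegative inner product with the gradient, which is twice the nearest point of `U` to `x`. -/
lemma inner_nearest_nonneg_of_forall_le (hU : Convex ℝ U)
    (hproj : ∀ x, proj x ∈ U ∧ ∀ y ∈ U, ‖x - proj x‖ ≤ ‖x - y‖) (x v : E)
    (hmin : ∀ t : ℝ, 0 < t → t ≤ 1 → ‖x‖ ^ 2 - ‖proj x - x‖ ^ 2 ≤
      ‖x + t • v‖ ^ 2 - ‖proj (x + t • v) - (x + t • v)‖ ^ 2) :
    0 ≤ ⟪v, proj x⟫ := by
  have key : ∀ t : ℝ, 0 < t → t ≤ 1 → -⟪v, proj x⟫ ≤ t * ‖v‖ ^ 2 := by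
    intro t ht ht1
    have hm := hmin t ht ht1
    have hnear := pow_le_pow_left₀ (norm_nonneg _)
      ((hproj x).2 _ (hproj (x + t • v)).1) 2
    have hlip := norm_nearest_sub_nearest_le hU hproj (x + t • v) x
    rw [add_sub_cancel_left, norm_smul, Real.norm_of_nonneg ht.le] at hlip
    have hcs := real_inner_le_norm v (proj (x + t • v) - proj x)
    set w := proj (x + t • v)
    have hw : 0 ≤ ⟪v, w⟫ := by
      rw [norm_sub_rev (proj x) x, norm_sub_sq_real w, real_inner_comm, inner_add_left,
        real_inner_smul_left] at hm
      rw [norm_sub_sq_real x w] at hnear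
      have : 0 ≤ t * ⟪v, w⟫ := by linarith
      exact nonneg_of_mul_nonneg_right this ht
    rw [inner_sub_right] at hcs
    nlinarith [mul_le_mul_of_nonneg_left hlip (norm_nonneg v)]
  by_contra! hneg
  have hpos : 0 < ‖v‖ ^ 2 + 1 := by positivity
  set c := -⟪v, proj x⟫ with hc
  have hc0 : 0 < c := by linarith
  have ht : 0 < min 1 (c / (‖v‖ ^ 2 + 1)) := lt_min one_pos (div_pos hc0 hpos)
  have h1 := key _ ht (min_le_left _ _)
  have h2 := (le_div_iff₀ hpos).1 (min_le_right 1 (c / (‖v‖ ^ 2 + 1)))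
  linarith

end NearestPoint

lemma inner_difference_transpose (n : ℕ)
    (L : EuclideanSpace ℝ (Fin n) →L[ℝ] EuclideanSpace ℝ (Fin (n + 1)))
    (hL : ∀ p j, L p j =
      ∑ i : Fin n, (if j = i.castSucc then (1 : ℝ) else if j = i.succ then -1 else 0) * p i)
    (p : EuclideanSpace ℝ (Fin n)) (u : EuclideanSpace ℝ (Fin (n + 1))) :
    ⟪L p, u⟫ = ∑ i : Fin n, p i * (u i.castSucc - u i.succ) := by
  simp only [PiLp.inner_apply, hL, RCLike.inner_apply, conj_trivial, Finset.mul_sum]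
  rw [Finset.sum_comm]
  refine Finset.sum_congr rfl fun i _ => ?_
  have hcoef : ∀ j : Fin (n + 1),
      u j * ((if j = i.castSucc then (1 : ℝ) else if j = i.succ then -1 else 0) * p i) =
        (if j = i.castSucc then p i * u j else 0) - (if j = i.succ then p i * u j else 0) := by
    intro j
    have := (Fin.castSucc_lt_succ (i := i)).ne
    split_ifs with h1 h2
    · exact absurd (h1.symm.trans h2) this
    all_goals ring
  simp only [hcoef, Finset.sum_sub_distrib, Finset.sum_ite_eq', Finset.mem_univ, if_true]
  ring

/-- (Lemma 1.) Vectors live in `ℝ^{n+1}` (ambient dimension `≥ 2` since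
`1 ≤ n`). `L` is the (linear map induced by the) `(n+1)×n` matrix with `L_{i,i} = 1`,
`L_{i+1,i} = −1` and zeros elsewhere, `proj = Π_U` is the Euclidean nearest-point
projection onto the nonempty compact convex set `U`, and
`h(p) := ‖b − λLp‖² − ‖Π_U(b − λLp) − (b − λLp)‖²`. If `p⋆` minimizes `h` over the
closed unit `ℓ∞` ball `P^n = {p : ∀ i, |p_i| ≤ 1}`, then `u⋆ = Π_U(b − λLp⋆)` minimizes
`u ↦ λ‖Tu‖₁ + (1/2)‖u − b‖²` over `U`, where `‖Tu‖₁ = Σ_i |u_i − u_{i+1}|`. -/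
theorem stmt_0 (n : ℕ) (hn : 1 ≤ n)
    (b : EuclideanSpace ℝ (Fin (n + 1))) (lam : ℝ) (hlam : 0 < lam)
    (U : Set (EuclideanSpace ℝ (Fin (n + 1))))
    (hUne : U.Nonempty) (hUcomp : IsCompact U) (hUconv : Convex ℝ U)
    (proj : EuclideanSpace ℝ (Fin (n + 1)) → EuclideanSpace ℝ (Fin (n + 1)))
    (hproj : ∀ x, proj x ∈ U ∧ ∀ y ∈ U, ‖x - proj x‖ ≤ ‖x - y‖)
    (L : EuclideanSpace ℝ (Fin n) →L[ℝ] EuclideanSpace ℝ (Fin (n + 1)))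
    (hL : ∀ p j, L p j =
      ∑ i : Fin n, (if j = i.castSucc then (1 : ℝ) else if j = i.succ then -1 else 0) * p i)
    (h : EuclideanSpace ℝ (Fin n) → ℝ)
    (hh : ∀ p, h p = ‖b - lam • L p‖ ^ 2 - ‖proj (b - lam • L p) - (b - lam • L p)‖ ^ 2)
    (pstar : EuclideanSpace ℝ (Fin n))
    (hpstar_mem : ∀ i, |pstar i| ≤ 1)
    (hpstar_min : ∀ p : EuclideanSpace ℝ (Fin n), (∀ i, |p i| ≤ 1) → h pstar ≤ h p) :
    proj (b - lam • L pstar) ∈ U ∧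
    ∀ u ∈ U,
      lam * (∑ i : Fin n,
          |proj (b - lam • L pstar) i.castSucc - proj (b - lam • L pstar) i.succ|) +
        (1 / 2 : ℝ) * ‖proj (b - lam • L pstar) - b‖ ^ 2 ≤
      lam * (∑ i : Fin n, |u i.castSucc - u i.succ|) + (1 / 2 : ℝ) * ‖u - b‖ ^ 2 := by
  refine ⟨(hproj _).1, fun u hu => ?_⟩
  have hinner := inner_difference_transpose n L hL
  set x := b - lam • L pstar with hx
  have hopt : ∀ q : EuclideanSpace ℝ (Fin n), (∀ i, |q i| ≤ 1) →
      ⟪L q, proj x⟫ ≤ ⟪L pstar, proj x⟫ := by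
    intro q hq
    have hv := inner_nearest_nonneg_of_forall_le hUconv hproj x (-(lam • L (q - pstar))) <| by
      intro t ht ht1
      have hmem : ∀ i, |(pstar + t • (q - pstar)) i| ≤ 1 := by
        intro i
        have h1 := abs_le.1 (hpstar_mem i)
        have h2 := abs_le.1 (hq i)
        simp only [PiLp.add_apply, PiLp.smul_apply, PiLp.sub_apply, smul_eq_mul]
        rw [abs_le]
        constructor <;> nlinarith
      have hle := hpstar_min _ hmem
      have hxt : b - lam • L (pstar + t • (q - pstar)) =
          x + t • -(lam • L (q - pstar)) := by
        rw [hx, map_add, map_smul]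
        module
      rwa [hh, hh, hxt] at hle
    rw [inner_neg_left, real_inner_smul_left, map_sub, inner_sub_left] at hv
    nlinarith
  have htv : ∑ i : Fin n, |proj x i.castSucc - proj x i.succ| ≤ ⟪L pstar, proj x⟫ := by
    refine le_trans (le_of_eq ?_) (hopt
      (WithLp.toLp 2 fun i => (SignType.sign (proj x i.castSucc - proj x i.succ) : ℝ)) ?_)
    · rw [hinner]
      exact Finset.sum_congr rfl fun i _ => (sign_mul_self _).symm
    · intro i
      dsimp only
      generalize SignType.sign (proj x i.castSucc - proj x i.succ) = s
      cases s <;> simp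
  have hu_tv : ⟪L pstar, u⟫ ≤ ∑ i : Fin n, |u i.castSucc - u i.succ| := by
    rw [hinner]
    refine Finset.sum_le_sum fun i _ => (le_abs_self _).trans ?_
    rw [abs_mul]
    exact mul_le_of_le_one_left (abs_nonneg _) (hpstar_mem i)
  have hnear := pow_le_pow_left₀ (norm_nonneg _) ((hproj x).2 u hu) 2
  have hexp : ∀ w : EuclideanSpace ℝ (Fin (n + 1)),
      lam * ⟪L pstar, w⟫ + 1 / 2 * ‖w - b‖ ^ 2 =
        1 / 2 * ‖x - w‖ ^ 2 + 1 / 2 * (‖b‖ ^ 2 - ‖x‖ ^ 2) := by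
    intro w
    rw [norm_sub_sq_real w b, norm_sub_sq_real x w, real_inner_comm b w]
    have : ⟪x, w⟫ = ⟪b, w⟫ - lam * ⟪L pstar, w⟫ := by
      rw [hx, inner_sub_left, real_inner_smul_left]
    linarith
  have h1 := mul_le_mul_of_nonneg_left htv hlam.le
  have h2 := mul_le_mul_of_nonneg_left hu_tv hlam.le
  linarith [hexp u, hexp (proj x)]
end

section
/- Let n ≥ 2, b ∈ ℝⁿ, λ > 0. The function h is differentiable on ℝ^{n−1}, and its gradient at every p ∈ ℝ^{n−1} is ∇h(p) = −2λ Lᵀ Π_U(b − λ L p). -/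
section NearestPoint

variable {E : Type*} [NormedAddCommGroup E] [InnerProductSpace ℝ E] {U : Set E} {P : E → E}

/-- The variational inequality characterising nearest points of a convex set. -/
theorem inner_sub_nearestPoint_nonpos (hU : Convex ℝ U)
    (hP : ∀ x, P x ∈ U ∧ ∀ y ∈ U, ‖x - P x‖ ≤ ‖x - y‖) (x : E) {u : E} (hu : u ∈ U) :
    inner ℝ (x - P x) (u - P x) ≤ 0 := by
  refine (norm_eq_iInf_iff_real_inner_le_zero hU (hP x).1).1 ?_ u hu
  have : Nonempty U := ⟨⟨P x, (hP x).1⟩⟩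
  refine le_antisymm (le_ciInf fun w => (hP x).2 w w.2) ?_
  exact ciInf_le (f := fun w : U => ‖x - w‖)
    ⟨0, by rintro _ ⟨w, rfl⟩; exact norm_nonneg _⟩ ⟨P x, (hP x).1⟩

/-- The nearest-point projection onto a convex set is nonexpansive. -/
theorem norm_nearestPoint_sub_le (hU : Convex ℝ U)
    (hP : ∀ x, P x ∈ U ∧ ∀ y ∈ U, ‖x - P x‖ ≤ ‖x - y‖) (x y : E) :
    ‖P y - P x‖ ≤ ‖y - x‖ := by
  have h₁ := inner_sub_nearestPoint_nonpos hU hP x (hP y).1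
  have h₂ := inner_sub_nearestPoint_nonpos hU hP y (hP x).1
  have h₃ : ‖P y - P x‖ ^ 2 - inner ℝ (y - x) (P y - P x) =
      inner ℝ (x - P x) (P y - P x) + inner ℝ (y - P y) (P x - P y) := by
    rw [← real_inner_self_eq_norm_sq]
    simp only [inner_sub_left, inner_sub_right]
    ring
  have h₄ := real_inner_le_norm (y - x) (P y - P x)
  by_contra! hlt
  nlinarith [norm_nonneg (y - x)]

theorem norm_sq_sub_norm_sub_sq (x u : E) :
    ‖x‖ ^ 2 - ‖u - x‖ ^ 2 = 2 * inner ℝ x u - ‖u‖ ^ 2 := by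
  rw [norm_sub_sq_real, real_inner_comm]
  ring

/-- `‖x‖² - dist(x, U)²` has derivative `2 ⟪P x, ·⟫`, where `P` projects onto the convex set `U`. -/
theorem hasFDerivAt_norm_sq_sub_dist_sq (hU : Convex ℝ U)
    (hP : ∀ x, P x ∈ U ∧ ∀ y ∈ U, ‖x - P x‖ ≤ ‖x - y‖) (x : E) :
    HasFDerivAt (fun y => ‖y‖ ^ 2 - ‖P y - y‖ ^ 2) (innerSL ℝ ((2 : ℝ) • P x)) x := by
  have hmax (z : E) {u : E} (hu : u ∈ U) :
      2 * inner ℝ z u - ‖u‖ ^ 2 ≤ 2 * inner ℝ z (P z) - ‖P z‖ ^ 2 := by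
    rw [← norm_sq_sub_norm_sub_sq, ← norm_sq_sub_norm_sub_sq, norm_sub_rev u, norm_sub_rev (P z)]
    have := (hP z).2 u hu
    gcongr
  have hO : (fun y => (‖y‖ ^ 2 - ‖P y - y‖ ^ 2) - (‖x‖ ^ 2 - ‖P x - x‖ ^ 2) -
      innerSL ℝ ((2 : ℝ) • P x) (y - x)) =O[nhds x] fun y => ‖y - x‖ ^ 2 := by
    refine Asymptotics.IsBigO.of_bound 2 (Filter.Eventually.of_forall fun y => ?_)
    have h₁ := hmax y (hP x).1
    have h₂ := hmax x (hP y).1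
    have h₃ := real_inner_le_norm (y - x) (P y - P x)
    have h₄ := mul_le_mul_of_nonneg_left (norm_nearestPoint_sub_le hU hP x y)
      (norm_nonneg (y - x))
    simp only [norm_sq_sub_norm_sub_sq, innerSL_apply_apply, inner_smul_left, inner_sub_right,
      inner_sub_left, RCLike.conj_to_real, real_inner_comm _ (P x)] at h₁ h₂ h₃ ⊢
    rw [Real.norm_eq_abs, Real.norm_of_nonneg (sq_nonneg _), abs_le]
    constructor <;> nlinarith [sq_nonneg ‖y - x‖]
  exact .of_isLittleO (hO.trans_isLittleO (Asymptotics.isLittleO_pow_sub_sub x one_lt_two))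

end NearestPoint

/-- (Lemma 2, differentiability part.) With ambient dimension `n+1 ≥ 2`
(`1 ≤ n`), `L` the `(n+1)×n` matrix with `L_{i,i} = 1`, `L_{i+1,i} = −1` (as a linear map),
`proj = Π_U` the Euclidean projection onto the nonempty compact convex set `U`, and
`h(p) := ‖b − λLp‖² − ‖Π_U(b − λLp) − (b − λLp)‖²`, the function `h` is differentiable
on `ℝⁿ` with gradient `∇h(p) = −2λ Lᵀ Π_U(b − λLp)` (where `Lᵀ` is the adjoint of `L`). -/
theorem stmt_3 (n : ℕ) (hn : 1 ≤ n)
    (b : EuclideanSpace ℝ (Fin (n + 1))) (lam : ℝ) (hlam : 0 < lam)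
    (U : Set (EuclideanSpace ℝ (Fin (n + 1))))
    (hUne : U.Nonempty) (hUcomp : IsCompact U) (hUconv : Convex ℝ U)
    (proj : EuclideanSpace ℝ (Fin (n + 1)) → EuclideanSpace ℝ (Fin (n + 1)))
    (hproj : ∀ x, proj x ∈ U ∧ ∀ y ∈ U, ‖x - proj x‖ ≤ ‖x - y‖)
    (L : EuclideanSpace ℝ (Fin n) →L[ℝ] EuclideanSpace ℝ (Fin (n + 1)))
    (hL : ∀ p j, L p j =
      ∑ i : Fin n, (if j = i.castSucc then (1 : ℝ) else if j = i.succ then -1 else 0) * p i)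
    (h : EuclideanSpace ℝ (Fin n) → ℝ)
    (hh : ∀ p, h p = ‖b - lam • L p‖ ^ 2 - ‖proj (b - lam • L p) - (b - lam • L p)‖ ^ 2) :
    ∀ p, HasGradientAt h
      ((-(2 * lam)) • (ContinuousLinearMap.adjoint L) (proj (b - lam • L p))) p := by
  intro p
  have hA : HasFDerivAt (fun q => b - lam • L q) (-(lam • L)) p :=
    (L.hasFDerivAt.const_smul lam).const_sub b
  have hc := (hasFDerivAt_norm_sq_sub_dist_sq hUconv hproj (b - lam • L p)).comp p hA
  rw [hasGradientAt_iff_hasFDerivAt]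
  refine (hc.congr_fderiv ?_).congr_of_eventuallyEq (Filter.Eventually.of_forall hh)
  ext q
  simp [ContinuousLinearMap.adjoint_inner_left]
  ring
end

section
/- (Sufficient decrease of the backward–forward/proximal-gradient step.) Let E be ℝⁿ with the Euclidean inner product, let f : E → ℝ be a convex differentiable function whose gradient is Lipschitz continuous with constant c > 0, let g : E → ℝ be a convex continuous function, and let U ⊆ E be a nonempty compact convex set. Fix u ∈ U and let p minimize x ↦ g(x) + (c/2)‖x − (u − (1/c)∇f(u))‖² over x ∈ U. Then f(p) + g(p) ≤ f(u) + g(u). -/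
/-- Descent lemma: a function with `c`-Lipschitz gradient is bounded above by its quadratic
model. -/
theorem le_add_inner_add_sq_of_lipschitz_gradient {F : Type*} [NormedAddCommGroup F]
    [InnerProductSpace ℝ F] [CompleteSpace F] {f : F → ℝ} {f' : F → F} {c : ℝ}
    (hf' : ∀ x, HasGradientAt f (f' x) x)
    (hlip : ∀ x y, ‖f' x - f' y‖ ≤ c * ‖x - y‖) (x d : F) :
    f (x + d) ≤ f x + inner ℝ (f' x) d + c / 2 * ‖d‖ ^ 2 := by
  have hderiv (t : ℝ) : HasDerivAt
      (fun s : ℝ => f (x + s • d) - s * inner ℝ (f' x) d - s ^ 2 * (c / 2 * ‖d‖ ^ 2))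
      (inner ℝ (f' (x + t • d) - f' x) d - t * (c * ‖d‖ ^ 2)) t := by
    have hline : HasDerivAt (fun s : ℝ => x + s • d) d t := by
      simpa using ((hasDerivAt_id t).smul_const d).const_add x
    have hcomp := (hf' (x + t • d)).hasFDerivAt.comp_hasDerivAt t hline
    have hlin := (hasDerivAt_id t).mul_const (inner ℝ (f' x) d)
    have hsq := (hasDerivAt_pow 2 t).mul_const (c / 2 * ‖d‖ ^ 2)
    refine ((hcomp.sub hlin).sub hsq).congr_deriv ?_
    rw [inner_sub_left, InnerProductSpace.toDual_apply_apply]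
    push_cast
    ring
  have hanti := antitoneOn_of_deriv_nonpos (convex_Icc (0 : ℝ) 1)
    (fun t _ => (hderiv t).continuousAt.continuousWithinAt)
    (fun t _ => (hderiv t).differentiableAt.differentiableWithinAt) (by
      intro t ht
      rw [interior_Icc] at ht
      rw [(hderiv t).deriv]
      have hgrad := hlip (x + t • d) x
      rw [add_sub_cancel_left, norm_smul, Real.norm_of_nonneg ht.1.le] at hgrad
      have hinner := real_inner_le_norm (f' (x + t • d) - f' x) d
      nlinarith [mul_le_mul_of_nonneg_right hgrad (norm_nonneg d)])
  have hle := hanti (Set.left_mem_Icc.2 zero_le_one) (Set.right_mem_Icc.2 zero_le_one) zero_le_one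
  simp only [one_smul, zero_smul, add_zero] at hle
  linarith


/-- (Sufficient decrease of the backward–forward/proximal-gradient step.)
Let `E = ℝⁿ` (Euclidean), `f : E → ℝ` convex and differentiable with `c`-Lipschitz
gradient (`c > 0`), `g : E → ℝ` convex and continuous, and `U ⊆ E` nonempty compact
convex. Fix `u ∈ U` and let `p` minimize `x ↦ g(x) + (c/2)‖x − (u − (1/c)∇f(u))‖²` over
`U`. Then `f(p) + g(p) ≤ f(u) + g(u)`. -/
theorem stmt_6 (n : ℕ)
    (f : EuclideanSpace ℝ (Fin n) → ℝ)
    (f' : EuclideanSpace ℝ (Fin n) → EuclideanSpace ℝ (Fin n))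
    (hfconv : ConvexOn ℝ Set.univ f)
    (hf' : ∀ x, HasGradientAt f (f' x) x)
    (c : ℝ) (hc : 0 < c)
    (hlip : ∀ x y, ‖f' x - f' y‖ ≤ c * ‖x - y‖)
    (g : EuclideanSpace ℝ (Fin n) → ℝ)
    (hgconv : ConvexOn ℝ Set.univ g) (hgcont : Continuous g)
    (U : Set (EuclideanSpace ℝ (Fin n)))
    (hUne : U.Nonempty) (hUcomp : IsCompact U) (hUconv : Convex ℝ U)
    (u : EuclideanSpace ℝ (Fin n)) (hu : u ∈ U)
    (p : EuclideanSpace ℝ (Fin n)) (hpU : p ∈ U)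
    (hpmin : ∀ x ∈ U,
      g p + (c / 2) * ‖p - (u - (1 / c) • f' u)‖ ^ 2 ≤
      g x + (c / 2) * ‖x - (u - (1 / c) • f' u)‖ ^ 2) :
    f p + g p ≤ f u + g u := by
  have hdescent := le_add_inner_add_sq_of_lipschitz_gradient hf' hlip u (p - u)
  rw [add_sub_cancel] at hdescent
  have hmin := hpmin u hu
  have hp : p - (u - (1 / c) • f' u) = (p - u) + (1 / c) • f' u := by abel
  have hcross : c / 2 * (2 * (1 / c * inner ℝ (f' u) (p - u))) = inner ℝ (f' u) (p - u) := by
    field_simp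
  rw [hp, sub_sub_cancel, norm_add_sq_real, inner_smul_right, real_inner_comm] at hmin
  linarith
end

section
/- (Lemma 3: monotonicity of S-ILC.) Let G be a real m×n matrix with G ≠ 0, r ∈ ℝᵐ, λ ≥ 0, and let c = ‖G‖² where ‖G‖ is the operator norm of G between Euclidean spaces. Let U ⊆ ℝⁿ be a nonempty compact convex set, and define F(u) := (1/2)‖Gu − r‖² + λ‖Tu‖₁. Suppose the sequence (u_k) in U satisfies: u_{k+1} minimizes u ↦ λ‖Tu‖₁ + (c/2)‖u − (u_k + (1/c) Gᵀ(r − G u_k))‖² over u ∈ U. Then F(u_{k+1}) ≤ F(u_k) for all k ≥ 0. -/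
/-- A gradient step with curvature `‖G‖ ^ 2` majorizes the least-squares functional: the decrease
of `½‖G x - r‖²` is at least the decrease of the squared distance to the step. -/
theorem half_norm_sub_sq_le_gradient_step {E H : Type*}
    [NormedAddCommGroup E] [InnerProductSpace ℝ E] [CompleteSpace E]
    [NormedAddCommGroup H] [InnerProductSpace ℝ H] [CompleteSpace H]
    (G : E →L[ℝ] H) (hG : G ≠ 0) (r : H) (x y : E) :
    (1 / 2 : ℝ) * ‖G y - r‖ ^ 2 +
        ‖G‖ ^ 2 / 2 * ‖x - (x + (1 / ‖G‖ ^ 2) • G.adjoint (r - G x))‖ ^ 2 ≤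
      (1 / 2 : ℝ) * ‖G x - r‖ ^ 2 +
        ‖G‖ ^ 2 / 2 * ‖y - (x + (1 / ‖G‖ ^ 2) • G.adjoint (r - G x))‖ ^ 2 := by
  have hc : ‖G‖ ^ 2 ≠ 0 := pow_ne_zero 2 (norm_ne_zero_iff.mpr hG)
  have hbound : ‖G (y - x)‖ ^ 2 ≤ ‖G‖ ^ 2 * ‖y - x‖ ^ 2 := by
    rw [← mul_pow]
    gcongr
    exact G.le_opNorm _
  have hy : G y - r = G (y - x) - (r - G x) := by
    rw [map_sub]
    abel
  have hstep : ‖G‖ ^ 2 * ‖y - (x + (1 / ‖G‖ ^ 2) • G.adjoint (r - G x))‖ ^ 2 =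
      ‖G‖ ^ 2 * ‖y - x‖ ^ 2 - 2 * inner ℝ (G (y - x)) (r - G x) +
        ‖G‖ ^ 2 * ‖(1 / ‖G‖ ^ 2) • G.adjoint (r - G x)‖ ^ 2 := by
    rw [← sub_sub, norm_sub_sq_real (y - x), inner_smul_right,
      ContinuousLinearMap.adjoint_inner_right]
    field_simp
  rw [sub_add_cancel_left, norm_neg, hy, norm_sub_sq_real, norm_sub_rev (G x) r]
  linarith

/-- (Lemma 3: monotonicity of S-ILC.) `G` is a nonzero real `m×(n+1)` matrix
(represented by its linear action between Euclidean spaces, with `Gᵀ` its adjoint),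
`r ∈ ℝᵐ`, `λ ≥ 0`, `c = ‖G‖²` (operator norm), `U ⊆ ℝ^{n+1}` nonempty compact convex, and
`F(u) := (1/2)‖Gu − r‖² + λ‖Tu‖₁` with `‖Tu‖₁ = Σ_i |u_i − u_{i+1}|`. If the sequence
`(u_k) ⊆ U` is such that `u_{k+1}` minimizes
`u ↦ λ‖Tu‖₁ + (c/2)‖u − (u_k + (1/c)Gᵀ(r − G u_k))‖²` over `U`, then
`F(u_{k+1}) ≤ F(u_k)` for all `k`. -/
theorem stmt_7 (m n : ℕ)
    (G : EuclideanSpace ℝ (Fin (n + 1)) →L[ℝ] EuclideanSpace ℝ (Fin m))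
    (hG : G ≠ 0)
    (r : EuclideanSpace ℝ (Fin m)) (lam : ℝ) (hlam : 0 ≤ lam)
    (c : ℝ) (hc : c = ‖G‖ ^ 2)
    (U : Set (EuclideanSpace ℝ (Fin (n + 1))))
    (hUne : U.Nonempty) (hUcomp : IsCompact U) (hUconv : Convex ℝ U)
    (F : EuclideanSpace ℝ (Fin (n + 1)) → ℝ)
    (hF : ∀ u, F u = (1 / 2 : ℝ) * ‖G u - r‖ ^ 2 +
      lam * ∑ i : Fin n, |u i.castSucc - u i.succ|)
    (u : ℕ → EuclideanSpace ℝ (Fin (n + 1)))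
    (humem : ∀ k, u k ∈ U)
    (hustep : ∀ k, ∀ v ∈ U,
      lam * (∑ i : Fin n, |u (k + 1) i.castSucc - u (k + 1) i.succ|) +
        (c / 2) * ‖u (k + 1) -
          (u k + (1 / c) • (ContinuousLinearMap.adjoint G) (r - G (u k)))‖ ^ 2 ≤
      lam * (∑ i : Fin n, |v i.castSucc - v i.succ|) +
        (c / 2) * ‖v - (u k + (1 / c) • (ContinuousLinearMap.adjoint G) (r - G (u k)))‖ ^ 2) :
    ∀ k, F (u (k + 1)) ≤ F (u k) := by
  intro k
  subst hc
  have hdescent := half_norm_sub_sq_le_gradient_step G hG r (u k) (u (k + 1))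
  have hmin := hustep k (u k) (humem k)
  rw [hF, hF]
  linarith
end
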